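/- For every real d > 0 and every real r > 0, the function h(r) = F_d(tanh²r) satisfies the strict inequality h'(r) < 4d² · h(r) · log(cosh r) / (sinh r · cosh r), where h' denotes the derivative of h and F_d(u) = ∑_{n=0}^∞ (∏_{j=0}^{n-1} (j² + d²)) · uⁿ / (n!)². -/

import Mathlib

/-- The real-valued form of the Gauss hypergeometric function `₂F₁(di, −di; 1; u)`. -/
noncomputable def Fhyp (d : ℝ) (u : ℝ) : ℝ :=
  ∑' n : ℕ, (∏ j ∈ Finset.range n, ((j : ℝ) ^ 2 + d ^ 2)) * u ^ n / ((n.factorial : ℝ)) ^ 2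

/-- The `n`-th Taylor coefficient of `Fhyp d` at the origin. -/
noncomputable def FhypCoeff (d : ℝ) (n : ℕ) : ℝ :=
  (∏ j ∈ Finset.range n, ((j : ℝ) ^ 2 + d ^ 2)) / (n.factorial : ℝ) ^ 2

/-- The derivative of `Fhyp d` inside the unit disc, as a power series. -/
noncomputable def FhypDeriv (d : ℝ) (u : ℝ) : ℝ :=
  ∑' n : ℕ, FhypCoeff d n * (n * u ^ (n - 1))

theorem Fhyp_eq_tsum (d u : ℝ) : Fhyp d u = ∑' n : ℕ, FhypCoeff d n * u ^ n := by
  unfold Fhyp FhypCoeff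
  congr 1
  ext n
  ring

theorem FhypCoeff_zero (d : ℝ) : FhypCoeff d 0 = 1 := by
  simp [FhypCoeff]

theorem FhypCoeff_pos {d : ℝ} (hd : 0 < d) (n : ℕ) : 0 < FhypCoeff d n := by
  unfold FhypCoeff
  have : 0 < ∏ j ∈ Finset.range n, ((j : ℝ) ^ 2 + d ^ 2) :=
    Finset.prod_pos fun j _ => by positivity
  positivity

theorem FhypCoeff_succ (d : ℝ) (n : ℕ) :
    ((n : ℝ) + 1) ^ 2 * FhypCoeff d (n + 1) = ((n : ℝ) ^ 2 + d ^ 2) * FhypCoeff d n := by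
  unfold FhypCoeff
  rw [Finset.prod_range_succ, Nat.factorial_succ]
  have : (n.factorial : ℝ) ≠ 0 := by positivity
  push_cast
  field_simp

theorem exists_FhypCoeff_le {d : ℝ} (hd : 0 < d) : ∃ C, 0 ≤ C ∧ ∀ n, FhypCoeff d n ≤ C := by
  obtain ⟨N, hN⟩ := exists_nat_ge (d ^ 2)
  have hpos := fun n => (FhypCoeff_pos hd n).le
  have hle : ∀ n ≤ N, FhypCoeff d n ≤ ∑ k ∈ Finset.range (N + 1), FhypCoeff d k := fun n hn =>
    Finset.single_le_sum (fun k _ => hpos k) (Finset.mem_range.2 (by omega))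
  refine ⟨∑ k ∈ Finset.range (N + 1), FhypCoeff d k, Finset.sum_nonneg fun k _ => hpos k,
    fun n => ?_⟩
  rcases le_total n N with h | h
  · exact hle n h
  · induction n, h using Nat.le_induction with
    | base => exact hle N le_rfl
    | succ n hn ih =>
      refine le_trans ?_ ih
      have hn' : (N : ℝ) ≤ n := by exact_mod_cast hn
      have h1 := FhypCoeff_succ d n
      have h2 : ((n : ℝ) ^ 2 + d ^ 2) * FhypCoeff d n ≤ ((n : ℝ) + 1) ^ 2 * FhypCoeff d n :=
        mul_le_mul_of_nonneg_right (by nlinarith) (hpos n)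
      exact le_of_mul_le_mul_left (h1.trans_le h2) (by positivity)

theorem summable_linear_growth_mul_pow {c : ℕ → ℝ} {C : ℝ} (hc : ∀ n, |c n| ≤ C * (n + 1)) {u : ℝ}
    (hu : |u| < 1) : Summable fun n => c n * u ^ n := by
  have hu' : ‖|u|‖ < 1 := by simpa using hu
  have h1 := summable_pow_mul_geometric_of_norm_lt_one 1 hu'
  have h0 := summable_pow_mul_geometric_of_norm_lt_one 0 hu'
  refine Summable.of_norm_bounded ((h1.add h0).mul_left C) fun n => ?_
  rw [Real.norm_eq_abs, abs_mul, abs_pow]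
  refine (mul_le_mul_of_nonneg_right (hc n) (by positivity)).trans_eq ?_
  ring

theorem hasDerivAt_tsum_linear_growth_mul_pow {c : ℕ → ℝ} {C : ℝ} (hc : ∀ n, |c n| ≤ C * (n + 1))
    {u : ℝ} (hu : |u| < 1) :
    HasDerivAt (fun x => ∑' n, c n * x ^ n) (∑' n, c n * (n * u ^ (n - 1))) u := by
  obtain ⟨ρ, hρ, hρ1⟩ := exists_between hu
  have hρ0 : 0 < ρ := (abs_nonneg u).trans_lt hρ
  have hρ' : ‖ρ‖ < 1 := by rwa [Real.norm_of_nonneg hρ0.le]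
  have h2 := summable_pow_mul_geometric_of_norm_lt_one 2 hρ'
  have h1 := summable_pow_mul_geometric_of_norm_lt_one 1 hρ'
  refine hasDerivAt_tsum_of_isPreconnected (t := Metric.ball 0 ρ) (y₀ := 0)
    (((h2.add h1).mul_left (C / ρ))) Metric.isOpen_ball
    (convex_ball (0 : ℝ) ρ).isPreconnected (fun n y _ => (hasDerivAt_pow n y).const_mul (c n))
    (fun n y hy => ?_) (by simpa using hρ0) (summable_linear_growth_mul_pow hc (by simp))
    (by simpa using hρ)
  have hy' : |y| ≤ ρ := by simpa using (mem_ball_zero_iff.1 hy).le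
  rcases n with _ | n
  · simp
  · rw [Real.norm_eq_abs, abs_mul, abs_mul, abs_pow, Nat.abs_cast, Nat.add_sub_cancel]
    calc |c (n + 1)| * (((n + 1 : ℕ) : ℝ) * |y| ^ n)
        ≤ C * (((n + 1 : ℕ) : ℝ) + 1) * (((n + 1 : ℕ) : ℝ) * ρ ^ n) := by
          gcongr
          · exact (abs_nonneg _).trans (hc _)
          · exact hc _
      _ = _ := by
          field_simp
          ring

theorem hasDerivAt_Fhyp {d : ℝ} (hd : 0 < d) {u : ℝ} (hu : |u| < 1) :
    HasDerivAt (Fhyp d) (FhypDeriv d u) u := by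
  obtain ⟨C, hC, hle⟩ := exists_FhypCoeff_le hd
  rw [show Fhyp d = fun x => ∑' n, FhypCoeff d n * x ^ n from funext (Fhyp_eq_tsum d)]
  refine hasDerivAt_tsum_linear_growth_mul_pow (C := C) (fun n => ?_) hu
  rw [abs_of_pos (FhypCoeff_pos hd n)]
  nlinarith [hle n, mul_nonneg hC n.cast_nonneg]

theorem summable_FhypDeriv {d : ℝ} (hd : 0 < d) {u : ℝ} (hu : |u| < 1) :
    Summable fun n : ℕ => FhypCoeff d n * (n * u ^ (n - 1)) := by
  obtain ⟨C, hC, hle⟩ := exists_FhypCoeff_le hd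
  rw [← summable_nat_add_iff 1]
  have := summable_linear_growth_mul_pow (c := fun n => FhypCoeff d (n + 1) * (n + 1)) (C := C)
    (fun n => by
      rw [abs_of_nonneg (mul_nonneg (FhypCoeff_pos hd _).le (by positivity))]
      exact mul_le_mul_of_nonneg_right (hle _) (by positivity)) hu
  simpa [mul_assoc] using this

theorem FhypDeriv_pos {d : ℝ} (hd : 0 < d) {u : ℝ} (hu0 : 0 < u) (hu : u < 1) :
    0 < FhypDeriv d u := by
  refine (summable_FhypDeriv hd (by rwa [abs_of_pos hu0])).tsum_pos (fun n => ?_) 1 ?_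
  · have := FhypCoeff_pos hd n
    positivity
  · simpa using FhypCoeff_pos hd 1

/-- The hypergeometric equation, in the form `(u F')' = d² F / (1 - u)`. -/
theorem hasDerivAt_mul_FhypDeriv {d : ℝ} (hd : 0 < d) {u : ℝ} (hu : |u| < 1) :
    HasDerivAt (fun x => x * FhypDeriv d x) (d ^ 2 * Fhyp d u / (1 - u)) u := by
  obtain ⟨C, hC, hle⟩ := exists_FhypCoeff_le hd
  have hbound : ∀ n : ℕ, |FhypCoeff d n * n| ≤ C * (n + 1) := fun n => by
    rw [abs_of_nonneg (mul_nonneg (FhypCoeff_pos hd n).le n.cast_nonneg)]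
    exact mul_le_mul (hle n) (by linarith) n.cast_nonneg hC
  have hfun : (fun x => x * FhypDeriv d x) = fun x => ∑' n : ℕ, FhypCoeff d n * n * x ^ n := by
    ext x
    rw [FhypDeriv, ← tsum_mul_left]
    congr 1
    ext n
    rcases n with _ | n
    · simp
    · rw [Nat.add_sub_cancel]
      ring
  rw [hfun]
  refine (hasDerivAt_tsum_linear_growth_mul_pow hbound hu).congr_deriv ?_
  have hF : Summable fun n => FhypCoeff d n * u ^ n := by
    refine summable_linear_growth_mul_pow (C := C) (fun n => ?_) hu
    rw [abs_of_pos (FhypCoeff_pos hd n)]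
    nlinarith [hle n, mul_nonneg hC n.cast_nonneg]
  have hsq : Summable fun n : ℕ => (n : ℝ) ^ 2 * FhypCoeff d n * u ^ n := by
    refine Summable.of_norm_bounded
      ((summable_pow_mul_geometric_of_norm_lt_one 2 (r := |u|) (by simpa using hu)).mul_left C)
      fun n => ?_
    rw [Real.norm_eq_abs, abs_mul, abs_pow, abs_mul, abs_of_pos (FhypCoeff_pos hd n), abs_pow,
      Nat.abs_cast]
    calc (n : ℝ) ^ 2 * FhypCoeff d n * |u| ^ n ≤ (n : ℝ) ^ 2 * C * |u| ^ n := by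
          gcongr
          exact hle n
      _ = _ := by ring
  set T := ∑' n : ℕ, FhypCoeff d n * n * (n * u ^ (n - 1)) with hT
  have hmul : u * T = ∑' n : ℕ, (n : ℝ) ^ 2 * FhypCoeff d n * u ^ n := by
    rw [hT, ← tsum_mul_left]
    congr 1
    ext n
    rcases n with _ | n
    · simp
    · rw [Nat.add_sub_cancel]
      ring
  have hshift : T = ∑' n : ℕ, ((n : ℝ) ^ 2 * FhypCoeff d n * u ^ n +
      d ^ 2 * (FhypCoeff d n * u ^ n)) := by
    have hterm : ∀ n : ℕ, FhypCoeff d (n + 1) * ((n + 1 : ℕ) : ℝ) *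
        (((n + 1 : ℕ) : ℝ) * u ^ (n + 1 - 1)) =
        (n : ℝ) ^ 2 * FhypCoeff d n * u ^ n + d ^ 2 * (FhypCoeff d n * u ^ n) := fun n => by
      rw [Nat.add_sub_cancel]
      push_cast
      linear_combination u ^ n * FhypCoeff_succ d n
    have hsum : Summable fun n : ℕ => FhypCoeff d n * n * (n * u ^ (n - 1)) := by
      rw [← summable_nat_add_iff 1]
      simp_rw [hterm]
      exact hsq.add (hF.mul_left _)
    rw [hT, hsum.tsum_eq_zero_add]
    simp_rw [hterm]
    simp
  rw [hsq.tsum_add (hF.mul_left _), tsum_mul_left, ← hmul, ← Fhyp_eq_tsum] at hshift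
  have : 1 - u ≠ 0 := by linarith [(abs_lt.1 hu).2]
  rw [eq_div_iff this]
  linarith

theorem mul_FhypDeriv_lt {d : ℝ} (hd : 0 < d) {u : ℝ} (hu0 : 0 < u) (hu1 : u < 1) :
    u * FhypDeriv d u < d ^ 2 * Fhyp d u * -Real.log (1 - u) := by
  let K := fun x => d ^ 2 * Fhyp d x * -Real.log (1 - x) - x * FhypDeriv d x
  have hK : ∀ x, 0 ≤ x → x < 1 →
      HasDerivAt K (d ^ 2 * FhypDeriv d x * -Real.log (1 - x)) x := fun x hx0 hx1 => by
    have hx : |x| < 1 := by rwa [abs_of_nonneg hx0]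
    have hne : 1 - x ≠ 0 := by linarith
    have hlog : HasDerivAt (fun x => -Real.log (1 - x)) (1 / (1 - x)) x :=
      ((((hasDerivAt_id' x).const_sub 1).log hne).neg).congr_deriv (by ring)
    refine ((((hasDerivAt_Fhyp hd hx).const_mul (d ^ 2)).mul hlog).sub
      (hasDerivAt_mul_FhypDeriv hd hx)).congr_deriv ?_
    ring
  have hmono : StrictMonoOn K (Set.Ico 0 1) := by
    refine strictMonoOn_of_deriv_pos (convex_Ico 0 1)
      (fun x hx => (hK x hx.1 hx.2).continuousAt.continuousWithinAt) fun x hx => ?_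
    rw [interior_Ico] at hx
    rw [(hK x hx.1.le hx.2).deriv]
    have hlog : 0 < -Real.log (1 - x) :=
      neg_pos.2 (Real.log_neg (by linarith [hx.2]) (by linarith [hx.1]))
    have := FhypDeriv_pos hd hx.1 hx.2
    positivity
  have h := hmono (Set.left_mem_Ico.2 one_pos) ⟨hu0.le, hu1⟩ hu0
  simp only [K, sub_zero, Real.log_one, neg_zero, mul_zero, zero_mul, sub_self] at h
  linarith

/-- For every `d > 0` and every `r > 0`, the function `h(r) = F_d(tanh² r)` satisfies
`h'(r) < 4d² · h(r) · log(cosh r) / (sinh r · cosh r)`. -/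
theorem deriv_Fhyp_tanh_sq_lt (d : ℝ) (hd : 0 < d) (r : ℝ) (hr : 0 < r) :
    deriv (fun r : ℝ => Fhyp d (Real.tanh r ^ 2)) r <
      4 * d ^ 2 * Fhyp d (Real.tanh r ^ 2) * Real.log (Real.cosh r) /
        (Real.sinh r * Real.cosh r) := by
  have hs : 0 < Real.sinh r := Real.sinh_pos_iff.2 hr
  have hc : 0 < Real.cosh r := Real.cosh_pos r
  have hone : 1 - Real.tanh r ^ 2 = (Real.cosh r ^ 2)⁻¹ := by
    rw [Real.tanh_eq_sinh_div_cosh]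
    field_simp
    linarith [Real.cosh_sq r]
  have hu0 : 0 < Real.tanh r ^ 2 := by
    rw [Real.tanh_eq_sinh_div_cosh]
    positivity
  have hu1 : Real.tanh r ^ 2 < 1 := by
    have : 0 < (Real.cosh r ^ 2)⁻¹ := by positivity
    linarith
  have htanh : HasDerivAt (fun r => Real.tanh r ^ 2)
      (2 * Real.sinh r / Real.cosh r ^ 3) r := by
    rw [show (fun r => Real.tanh r ^ 2) = fun r => (Real.sinh r / Real.cosh r) ^ 2 from
      funext fun x => by rw [Real.tanh_eq_sinh_div_cosh]]
    refine (((Real.hasDerivAt_sinh r).div (Real.hasDerivAt_cosh r) hc.ne').pow 2).congr_deriv ?_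
    rw [show Real.cosh r * Real.cosh r - Real.sinh r * Real.sinh r = 1 by
      linarith [Real.cosh_sq r]]
    simp only [Pi.div_apply, Nat.add_one_sub_one, pow_one]
    field_simp
    norm_num
  have hF := hasDerivAt_Fhyp hd (u := Real.tanh r ^ 2) (by rwa [abs_of_pos hu0])
  have hcomp : HasDerivAt (fun r => Fhyp d (Real.tanh r ^ 2))
      (FhypDeriv d (Real.tanh r ^ 2) * (2 * Real.sinh r / Real.cosh r ^ 3)) r :=
    HasDerivAt.comp (h₂ := Fhyp d) r hF htanh
  rw [hcomp.deriv]
  have key := mul_FhypDeriv_lt hd hu0 hu1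
  rw [hone, Real.log_inv, neg_neg, Real.log_pow] at key
  generalize FhypDeriv d (Real.tanh r ^ 2) = A at *
  generalize Fhyp d (Real.tanh r ^ 2) = B at *
  rw [Real.tanh_eq_sinh_div_cosh] at key
  rw [lt_div_iff₀ (by positivity)]
  calc A * (2 * Real.sinh r / Real.cosh r ^ 3) * (Real.sinh r * Real.cosh r)
      = 2 * ((Real.sinh r / Real.cosh r) ^ 2 * A) := by field_simp
    _ < 2 * (d ^ 2 * B * ((2 : ℕ) * Real.log (Real.cosh r))) := by gcongr
    _ = _ := by
      push_cast
      ring
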